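/- (Decrease of the optimal value function.) Let h_t be a terminal control law for terminal set 𝒳_t, and assume the terminal decrease condition: V_t(f^c(x', h_t(x'))) − V_t(x') ≤ −L^c(x', h_t(x')) for every x' ∈ 𝒳_t. Suppose (S, adaptive trajectory) is an optimal feasible solution of the adaptive OCP P^a(x) with horizon N, i.e. S is admissible, the trajectory is feasible for P^a(x), and its cost equals V*_N(x). Let u^l be its lifted controls and x⁺ = f^c(x, u^l_0). Then V*_N(x⁺) − V*_N(x) ≤ −L^c(x, u^l_0). -/

import Mathlib

/-- Abstract adaptive-complexity MPC framework: complex system, simple system,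
reduction `red` (ψ) with state component `redx` (ψ_x), lift `lift` (ψ†) with state
component `liftx` (ψ†_x), satisfying ψ ∘ ψ† = id. -/
structure ACSys (Xc Uc Xs Us : Type*) where
  fc : Xc × Uc → Xc
  fs : Xs × Us → Xs
  Zc : Set (Xc × Uc)
  Zs : Set (Xs × Us)
  red : Xc × Uc → Xs × Us
  redx : Xc → Xs
  lift : Xs × Us → Xc × Uc
  liftx : Xs → Xc
  redx_spec : ∀ z : Xc × Uc, (red z).1 = redx z.1
  liftx_spec : ∀ z : Xs × Us, (lift z).1 = liftx z.1
  red_lift : ∀ z : Xs × Us, red (lift z) = z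

/-- An adaptive trajectory: complex-space data `(xC i, uC i)` used when `i ∉ S`,
simple-space data `(xS i, uS i)` used when `i ∈ S`. -/
structure ACTraj (Xc Uc Xs Us : Type*) where
  xC : ℕ → Xc
  uC : ℕ → Uc
  xS : ℕ → Xs
  uS : ℕ → Us

variable {Xc Uc Xs Us : Type*}

/-- The lifted state-control pair `z^l_i`. -/
def zl (A : ACSys Xc Uc Xs Us) (S : Finset ℕ) (T : ACTraj Xc Uc Xs Us) (i : ℕ) : Xc × Uc :=
  if i ∈ S then A.lift (T.xS i, T.uS i) else (T.xC i, T.uC i)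

/-- The lifted state `x^l_i`. -/
def xl (A : ACSys Xc Uc Xs Us) (S : Finset ℕ) (T : ACTraj Xc Uc Xs Us) (i : ℕ) : Xc :=
  if i ∈ S then A.liftx (T.xS i) else T.xC i

/-- The lifted control sequence `u^l`. -/
def ul (A : ACSys Xc Uc Xs Us) (S : Finset ℕ) (T : ACTraj Xc Uc Xs Us) : ℕ → Uc :=
  fun i => (zl A S T i).2

/-- The adaptive dynamics: the four cases according to membership of `i`, `i+1` in `S`. -/
def AdaptDyn (A : ACSys Xc Uc Xs Us) (N : ℕ) (S : Finset ℕ) (T : ACTraj Xc Uc Xs Us) : Prop :=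
  ∀ i, i < N →
    (i ∉ S → i + 1 ∉ S → T.xC (i + 1) = A.fc (T.xC i, T.uC i)) ∧
    (i ∉ S → i + 1 ∈ S → T.xS (i + 1) = A.redx (A.fc (T.xC i, T.uC i))) ∧
    (i ∈ S → i + 1 ∉ S → T.xC (i + 1) = A.fc (A.lift (T.xS i, T.uS i))) ∧
    (i ∈ S → i + 1 ∈ S → T.xS (i + 1) = A.fs (T.xS i, T.uS i))

/-- Admissibility of the simplicity set `S` for an adaptive trajectory:
for each `i ∈ S`, (i) `1 ≤ i ≤ N-1`; (ii) `ψ†(ψ(z^l_i)) ∈ 𝒵^c`;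
(iii) `ψ†_x(f^s(ψ(z^l_i))) = f^c(z^l_i)`; (iv) `ψ†_x(ψ_x(f^c(z^l_{i-1}))) = f^c(z^l_{i-1})`. -/
def AdmissibleSet (A : ACSys Xc Uc Xs Us) (N : ℕ) (S : Finset ℕ) (T : ACTraj Xc Uc Xs Us) : Prop :=
  ∀ i ∈ S,
    (1 ≤ i ∧ i < N) ∧
    A.lift (A.red (zl A S T i)) ∈ A.Zc ∧
    A.liftx (A.fs (A.red (zl A S T i))) = A.fc (zl A S T i) ∧
    A.liftx (A.redx (A.fc (zl A S T (i - 1)))) = A.fc (zl A S T (i - 1))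

/-- The solution map φ of the complex system: `φ 0 x u = x`, `φ (i+1) x u = f^c(φ i x u, u i)`. -/
def Phi (A : ACSys Xc Uc Xs Us) : ℕ → Xc → (ℕ → Uc) → Xc
  | 0, x, _ => x
  | i + 1, x, u => A.fc (Phi A i x u, u i)

/-- Feasibility of an adaptive trajectory for the adaptive OCP `P^a(x)` with horizon `N`
and terminal set `Xt`. -/
def FeasAdapt (A : ACSys Xc Uc Xs Us) (N : ℕ) (S : Finset ℕ) (T : ACTraj Xc Uc Xs Us)
    (Xt : Set Xc) (x : Xc) : Prop :=
  T.xC 0 = x ∧ (∀ i ∈ S, (T.xS i, T.uS i) ∈ A.Zs) ∧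
    (∀ i, i < N → i ∉ S → (T.xC i, T.uC i) ∈ A.Zc) ∧ T.xC N ∈ Xt

/-- A terminal control law for terminal set `Xt`. -/
def TermLaw (A : ACSys Xc Uc Xs Us) (Xt : Set Xc) (ht : Xc → Uc) : Prop :=
  ∀ x ∈ Xt, (x, ht x) ∈ A.Zc ∧ A.fc (x, ht x) ∈ Xt

/-- Feasibility of a control sequence for the complex OCP `P(x)` with horizon `N`. -/
def FeasComplex (A : ACSys Xc Uc Xs Us) (N : ℕ) (Xt : Set Xc) (x : Xc) (u : ℕ → Uc) : Prop :=
  (∀ i, i < N → (Phi A i x u, u i) ∈ A.Zc) ∧ Phi A N x u ∈ Xt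

/-- The adaptive feasibility region `X_N`. -/
def XNreg (A : ACSys Xc Uc Xs Us) (N : ℕ) (Xt : Set Xc) : Set Xc :=
  {x | ∃ (S : Finset ℕ) (T : ACTraj Xc Uc Xs Us),
    AdmissibleSet A N S T ∧ AdaptDyn A N S T ∧ FeasAdapt A N S T Xt x}

/-- The set of states admitting a feasible complex OCP solution with horizon `N`. -/
def XcplxSet (A : ACSys Xc Uc Xs Us) (N : ℕ) (Xt : Set Xc) : Set Xc :=
  {x | ∃ u : ℕ → Uc, FeasComplex A N Xt x u}

/-- The cost of an adaptive trajectory: `Σ_{i<N} L^c(z^l_i) + V_t(x^l_N)`. -/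
noncomputable def trajCost (A : ACSys Xc Uc Xs Us) (N : ℕ) (S : Finset ℕ)
    (T : ACTraj Xc Uc Xs Us) (Lc : Xc × Uc → ℝ) (Vt : Xc → ℝ) : ℝ :=
  (∑ i ∈ Finset.range N, Lc (zl A S T i)) + Vt (xl A S T N)

/-- The optimal value `V*_N(x)`: infimum of costs over admissible simplicity sets and
feasible adaptive trajectories for `P^a(x)`. -/
noncomputable def Vstar (A : ACSys Xc Uc Xs Us) (N : ℕ) (Xt : Set Xc)
    (Lc : Xc × Uc → ℝ) (Vt : Xc → ℝ) (x : Xc) : ℝ :=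
  sInf {c | ∃ (S : Finset ℕ) (T : ACTraj Xc Uc Xs Us),
    AdmissibleSet A N S T ∧ AdaptDyn A N S T ∧ FeasAdapt A N S T Xt x ∧
    c = trajCost A N S T Lc Vt}

theorem zl_fst_aux (A : ACSys Xc Uc Xs Us) (S : Finset ℕ) (T : ACTraj Xc Uc Xs Us) (i : ℕ) :
    (zl A S T i).1 = xl A S T i := by
  unfold zl xl
  split_ifs
  · rw [A.liftx_spec]
  · rfl

theorem xl_succ_aux (A : ACSys Xc Uc Xs Us) (N : ℕ) (S : Finset ℕ) (T : ACTraj Xc Uc Xs Us)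
    (hadm : AdmissibleSet A N S T) (hdyn : AdaptDyn A N S T) (i : ℕ) (hi : i < N) :
    xl A S T (i + 1) = A.fc (zl A S T i) := by
  obtain ⟨h1, h2, h3, h4⟩ := hdyn i hi
  by_cases a : i ∈ S <;> by_cases b : i + 1 ∈ S
  · have := (hadm i a).2.2.1
    simp only [zl, xl, a, b, if_true, A.red_lift] at this ⊢
    rw [h4 a b, this]
  · simp only [zl, xl, a, b, if_true, if_false]
    exact h3 a b
  · have := (hadm (i + 1) b).2.2.2
    simp only [zl, xl, a, b, if_true, if_false, Nat.add_sub_cancel] at this ⊢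
    rw [h2 a b, this]
  · simp only [zl, xl, a, b, if_false]
    exact h1 a b

theorem zl_mem_aux (A : ACSys Xc Uc Xs Us) (N : ℕ) (S : Finset ℕ) (T : ACTraj Xc Uc Xs Us)
    (Xt : Set Xc) (x : Xc) (hadm : AdmissibleSet A N S T) (hfeas : FeasAdapt A N S T Xt x)
    (i : ℕ) (hi : i < N) : zl A S T i ∈ A.Zc := by
  by_cases a : i ∈ S
  · have := (hadm i a).2.1
    simpa only [zl, a, if_true, A.red_lift] using this
  · have := hfeas.2.2.1 i hi a
    simpa only [zl, a, if_false] using this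

/-- decrease of the optimal value function: for an optimal feasible solution of
the adaptive OCP `P^a(x)` with lifted controls `u^l` and successor state `x⁺ = f^c(x, u^l_0)`,
`V*_N(x⁺) − V*_N(x) ≤ −L^c(x, u^l_0)`. -/
theorem optimal_value_decrease
    (A : ACSys Xc Uc Xs Us) (N : ℕ) (hN : 1 ≤ N) (Xt : Set Xc) (ht : Xc → Uc)
    (hht : TermLaw A Xt ht)
    (Lc : Xc × Uc → ℝ) (Vt : Xc → ℝ)
    (hLc : ∀ z : Xc × Uc, 0 ≤ Lc z) (hVt : ∀ y : Xc, 0 ≤ Vt y)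
    (hdec : ∀ y ∈ Xt, Vt (A.fc (y, ht y)) - Vt y ≤ - Lc (y, ht y))
    (S : Finset ℕ) (T : ACTraj Xc Uc Xs Us)
    (hadm : AdmissibleSet A N S T) (hdyn : AdaptDyn A N S T)
    (x : Xc) (hfeas : FeasAdapt A N S T Xt x)
    (hopt : trajCost A N S T Lc Vt = Vstar A N Xt Lc Vt x) :
    Vstar A N Xt Lc Vt (A.fc (x, ul A S T 0)) - Vstar A N Xt Lc Vt x
      ≤ - Lc (x, ul A S T 0) := by
  obtain ⟨M, rfl⟩ : ∃ M, N = M + 1 := ⟨N - 1, by omega⟩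
  have h0 : 0 ∉ S := fun h => by have := (hadm 0 h).1; omega
  have hMS : M + 1 ∉ S := fun h => by have := (hadm _ h).1; omega
  have hx0 : (x, ul A S T 0) = zl A S T 0 := by
    simp [ul, zl, h0, hfeas.1]
  have hxN : xl A S T (M + 1) = T.xC (M + 1) := by simp [xl, hMS]
  have hNt : xl A S T (M + 1) ∈ Xt := by rw [hxN]; exact hfeas.2.2.2
  set y := xl A S T (M + 1) with hy
  let T' : ACTraj Xc Uc Xs Us :=
    { xC := fun i => if i ≤ M then xl A S T (i + 1) else A.fc (y, ht y)
      uC := fun i => if i < M then ul A S T (i + 1) else ht y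
      xS := T.xS
      uS := T.uS }
  have hz1 : ∀ i, i < M → (T'.xC i, T'.uC i) = zl A S T (i + 1) := by
    intro i hi
    have hi' : i ≤ M := hi.le
    simp only [T', hi, hi', if_true, ul, ← zl_fst_aux]
  have hz2 : (T'.xC M, T'.uC M) = (y, ht y) := by
    simp [T', hy]
  have hxe : T'.xC (M + 1) = A.fc (y, ht y) := by simp [T']
  have hd : AdaptDyn A (M + 1) ∅ T' := by
    intro i hi
    refine ⟨fun _ _ => ?_, by simp, by simp, by simp⟩
    rcases Nat.lt_or_ge i M with h | h
    · rw [hz1 i h, ← xl_succ_aux A (M + 1) S T hadm hdyn (i + 1) (by omega)]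
      have : i + 1 ≤ M := h
      simp only [T', this, if_true]
    · obtain rfl : i = M := by omega
      rw [hz2, hxe]
  have hf : FeasAdapt A (M + 1) ∅ T' Xt (A.fc (x, ul A S T 0)) := by
    refine ⟨?_, by simp, ?_, ?_⟩
    · rw [hx0, ← xl_succ_aux A (M + 1) S T hadm hdyn 0 (by omega)]
      simp [T']
    · intro i hi _
      rcases Nat.lt_or_ge i M with h | h
      · rw [hz1 i h]
        exact zl_mem_aux A (M + 1) S T Xt x hadm hfeas _ (by omega)
      · obtain rfl : i = M := by omega
        rw [hz2]
        exact (hht y hNt).1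
    · rw [hxe]
      exact (hht y hNt).2
  have hle : Vstar A (M + 1) Xt Lc Vt (A.fc (x, ul A S T 0)) ≤ trajCost A (M + 1) ∅ T' Lc Vt := by
    apply csInf_le
    · refine ⟨0, ?_⟩
      rintro c ⟨S2, T2, -, -, -, rfl⟩
      exact add_nonneg (Finset.sum_nonneg fun i _ => hLc _) (hVt _)
    · exact ⟨∅, T', by intro i hi; simp at hi, hd, hf, rfl⟩
  have hc : trajCost A (M + 1) ∅ T' Lc Vt =
      (∑ i ∈ Finset.range M, Lc (zl A S T (i + 1))) + Lc (y, ht y) + Vt (A.fc (y, ht y)) := by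
    have e : ∀ i, zl A ∅ T' i = (T'.xC i, T'.uC i) := fun i => by simp [zl]
    have e2 : xl A ∅ T' (M + 1) = A.fc (y, ht y) := by
      rw [← hxe]; simp [xl]
    rw [trajCost, e2, Finset.sum_range_succ, e M, hz2]
    congr 2
    refine Finset.sum_congr rfl fun i hi => ?_
    rw [e, hz1 i (Finset.mem_range.1 hi)]
  have hc0 : trajCost A (M + 1) S T Lc Vt =
      (∑ i ∈ Finset.range M, Lc (zl A S T (i + 1))) + Lc (zl A S T 0) + Vt y := by
    rw [trajCost, Finset.sum_range_succ']
  have := hdec y hNt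
  rw [hx0] at hle ⊢
  linarith
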